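/- arXiv:2309.02749 — 2 statements merged into one kernel-verified Lean document; each statement's English description precedes it below -/
import Mathlib

section
/- For every extended finite automaton A over the additive group ℤ^k (k a positive integer) and every positive integer c, it is algorithmically decidable whether gmc_A(n) ≤ c for all n. -/
open scoped Classical

/-- An extended finite automaton (EFA) over a group `M`, with input alphabet `V`:
a finite automaton whose transitions additionally multiply a group register by elements
of `M`. -/
structure EFA (V M : Type) [Group M] where
  /-- States. -/
  Q : Type
  [fQ : Fintype Q]
  /-- Transition function: finitely many (state, group element) pairs per state and letter. -/
  δ : Q → V → Set (Q × M)
  fin : ∀ q a, (δ q a).Finite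
  /-- Initial state. -/
  q₀ : Q
  /-- Final states. -/
  F : Set Q

variable {V M : Type} [Group M]

/-- `A.Steps c c' k` : the EFA `A` goes from configuration `c` (state, remaining input,
register) to configuration `c'` using exactly `k` transitions whose group element is not the
identity. -/
inductive EFA.Steps (A : EFA V M) :
    A.Q × List V × M → A.Q × List V × M → ℕ → Prop
  | refl (c : A.Q × List V × M) : Steps A c c 0
  | step {s : A.Q} {r : M} {q : A.Q} {w : List V} {m : M} {c : A.Q × List V × M} {k : ℕ}
      {a : V} (h : (s, r) ∈ A.δ q a) (ih : Steps A (s, w, m * r) c k) :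
      Steps A (q, a :: w, m) c (if r = 1 then k else k + 1)

/-- The word `w` is accepted using exactly `k` non-identity group elements: starting from the
initial state with register `1`, the whole input is read and a final state is reached with
register `1`. -/
def EFA.AcceptsN (A : EFA V M) (w : List V) (k : ℕ) : Prop :=
  ∃ q ∈ A.F, A.Steps (A.q₀, w, 1) (q, [], 1) k

/-- The language accepted by an EFA. -/
def EFA.language (A : EFA V M) : Language V := {w | ∃ k, A.AcceptsN w k}

/-- Group memory complexity of a word: the minimal number of non-identity group elements used
over all accepting computations (`0` if the word is not accepted). -/
noncomputable def EFA.gmcW (A : EFA V M) (w : List V) : ℕ :=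
  sInf {k | A.AcceptsN w k}

/-- Group memory complexity of the EFA: maximum over words of length `n`. -/
noncomputable def EFA.gmcFun (A : EFA V M) (n : ℕ) : ℕ :=
  sSup {m | ∃ w : List V, w.length = n ∧ A.gmcW w = m}

/-- `f ∈ O(h)` for `ℕ`-valued functions. -/
def InO (f h : ℕ → ℕ) : Prop := ∃ c : ℕ, ∀ n, f n ≤ c * h n + c

/-- `f ∈ Ω(n)`: there is a rational constant `1/c > 0` with `f n ≥ n/c` for infinitely many `n`. -/
def InOmegaLinear (f : ℕ → ℕ) : Prop := ∃ c : ℕ, 0 < c ∧ ∀ m : ℕ, ∃ n ≥ m, n ≤ c * f n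

/-- Concrete (encodable) data describing an EFA over `ℤ^k` with input alphabet `Bool`:
`(m, ts, fs)` describes an automaton with states `Fin (m+1)`, initial state `0`, transitions
`ts` (source state, letter, target state, vector of `ℤ^k` given as a list of integers), and
final states `fs`. -/
abbrev EFAData : Type := ℕ × List (ℕ × Bool × ℕ × List ℤ) × List ℕ

/-- The element of the (multiplicatively written) group `ℤ^k` encoded by a list of integers. -/
def vecOf (k : ℕ) (l : List ℤ) : Multiplicative (Fin k → ℤ) :=
  Multiplicative.ofAdd (fun i => l.getD i 0)

/-- The EFA over `ℤ^k` described by `EFAData`. -/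
def toEFA (k : ℕ) (d : EFAData) : EFA Bool (Multiplicative (Fin k → ℤ)) where
  Q := Fin (d.1 + 1)
  fQ := inferInstance
  δ q a :=
    (fun e : ℕ × Bool × ℕ × List ℤ =>
        ((⟨e.2.2.1 % (d.1 + 1), Nat.mod_lt _ (Nat.succ_pos _)⟩ : Fin (d.1 + 1)),
          vecOf k e.2.2.2)) ''
      {e | e ∈ d.2.1 ∧ e.1 = q.1 ∧ e.2.1 = a}
  fin q a := Set.Finite.image _ ((d.2.1.finite_toSet).subset (fun _ he => he.1))
  q₀ := ⟨0, Nat.succ_pos _⟩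
  F := {q | q.1 ∈ d.2.2}


theorem Multiset.exists_le_card_eq_of_le {ι : Type} (L : Multiset ι) (n : ℕ)
    (h : n ≤ Multiset.card L) : ∃ T ≤ L, Multiset.card T = n := by
  induction L using Quotient.inductionOn with
  | _ l =>
    refine ⟨(l.take n : List ι), ?_, ?_⟩
    · exact (List.take_sublist n l).subperm
    · simpa using h

/-- Pigeonhole principle for a multiset labelled by positive integers at most `K`. -/
theorem exists_le_card_filter_of_labels {ι : Type} (f : ι → ℤ) (K : ℕ) (M : Multiset ι)
    (hf : ∀ x ∈ M, 1 ≤ f x ∧ f x ≤ K) (hc : K * K < Multiset.card M) :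
    ∃ v : ℕ, 1 ≤ v ∧ v ≤ K ∧ K ≤ Multiset.card (M.filter fun x => f x = v) := by
  by_contra! h
  have h1 := Multiset.sum_count_eq_card (s := Finset.Icc (1 : ℤ) K) (m := M.map f)
    (by
      intro a ha
      obtain ⟨x, hx, rfl⟩ := Multiset.mem_map.1 ha
      simpa using hf x hx)
  have h2 : ∑ a ∈ Finset.Icc (1 : ℤ) K, Multiset.count a (M.map f)
      ≤ ∑ a ∈ Finset.Icc (1 : ℤ) K, K := by
    refine Finset.sum_le_sum fun a ha => ?_
    rw [Finset.mem_Icc] at ha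
    have h3 := h a.toNat (by omega) (by omega)
    rw [Multiset.count_map]
    have h4 : ((a.toNat : ℕ) : ℤ) = a := by omega
    rw [h4] at h3
    simp only [eq_comm (a := a)]
    exact h3.le
  rw [h1] at h2
  simp at h2
  omega

theorem Multiset.sum_map_eq_card_mul {ι : Type} (f : ι → ℤ) (M : Multiset ι) (v : ℤ)
    (h : ∀ x ∈ M, f x = v) : (M.map f).sum = Multiset.card M * v := by
  rw [Multiset.map_congr rfl h]
  simp

theorem Multiset.sum_map_bounds {ι : Type} (f : ι → ℤ) (K : ℕ) (M : Multiset ι)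
    (hf : ∀ x ∈ M, 1 ≤ f x ∧ f x ≤ K) :
    (Multiset.card M : ℤ) ≤ (M.map f).sum ∧ (M.map f).sum ≤ K * Multiset.card M := by
  induction M using Multiset.induction_on with
  | empty => simp
  | cons a M ih =>
    have h1 := hf a (by simp)
    have h2 := ih fun x hx => hf x (by simp [hx])
    simp only [Multiset.card_cons, Multiset.map_cons, Multiset.sum_cons]
    push_cast
    constructor <;> linarith

/-- A large multiset of bounded integer labels with bounded sum contains a small nonempty
submultiset whose labels sum to zero. -/
theorem exists_zero_sum_block {ι : Type} (f : ι → ℤ) (K S : ℕ) (L : Multiset ι)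
    (hK : ∀ x ∈ L, |f x| ≤ K) (hS : |(L.map f).sum| ≤ S)
    (hc : S + K * (K * K) + K * K < Multiset.card L) :
    ∃ T ≤ L, T ≠ 0 ∧ Multiset.card T ≤ 2 * K + 1 ∧ (T.map f).sum = 0 := by
  by_cases hz : ∃ x ∈ L, f x = 0
  · obtain ⟨x, hx, h0⟩ := hz
    exact ⟨{x}, by simpa using hx, by simp, by simp, by simpa using h0⟩
  push Not at hz
  set P := L.filter fun x => 0 < f x with hP
  set N := L.filter fun x => ¬ 0 < f x with hN
  have hPN : P + N = L := Multiset.filter_add_not _ _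
  have hPf : ∀ x ∈ P, 1 ≤ f x ∧ f x ≤ K := by
    intro x hx
    rw [hP, Multiset.mem_filter] at hx
    have := abs_le.1 (hK x hx.1)
    omega
  have hNf : ∀ x ∈ N, 1 ≤ (-f x) ∧ (-f x) ≤ K := by
    intro x hx
    rw [hN, Multiset.mem_filter] at hx
    have := abs_le.1 (hK x hx.1)
    have := hz x hx.1
    omega
  have bP := Multiset.sum_map_bounds f K P hPf
  have bN := Multiset.sum_map_bounds (fun x => - f x) K N hNf
  rw [Multiset.sum_map_neg] at bN
  have hcard : Multiset.card P + Multiset.card N = Multiset.card L := by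
    rw [← hPN, Multiset.card_add]
  have hsum : (P.map f).sum + (N.map f).sum = (L.map f).sum := by
    rw [← hPN, Multiset.map_add, Multiset.sum_add]
  have hS' := abs_le.1 hS
  have hcP : K * K < Multiset.card P := by
    by_contra! h
    have : K * Multiset.card P ≤ K * (K * K) := Nat.mul_le_mul_left _ h
    zify at *
    linarith
  have hcN : K * K < Multiset.card N := by
    by_contra! h
    have : K * Multiset.card N ≤ K * (K * K) := Nat.mul_le_mul_left _ h
    zify at *
    linarith
  obtain ⟨a, ha1, haK, ha⟩ := exists_le_card_filter_of_labels f K P hPf hcP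
  obtain ⟨b, hb1, hbK, hb⟩ := exists_le_card_filter_of_labels _ K N hNf hcN
  obtain ⟨T1, hT1, hc1⟩ := Multiset.exists_le_card_eq_of_le _ b (hbK.trans ha)
  obtain ⟨T2, hT2, hc2⟩ := Multiset.exists_le_card_eq_of_le _ a (haK.trans hb)
  refine ⟨T1 + T2, ?_, ?_, ?_, ?_⟩
  · rw [← hPN]
    exact add_le_add (hT1.trans (Multiset.filter_le _ _)) (hT2.trans (Multiset.filter_le _ _))
  · intro h
    have := congrArg Multiset.card h
    simp at this
    simp [this.1] at hc1
    omega
  · rw [Multiset.card_add]; omega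
  · rw [Multiset.map_add, Multiset.sum_add,
      Multiset.sum_map_eq_card_mul f T1 a fun x hx =>
        (Multiset.mem_filter.1 (Multiset.mem_of_le hT1 hx)).2,
      Multiset.sum_map_eq_card_mul f T2 (-b) fun x hx => by
        have := (Multiset.mem_filter.1 (Multiset.mem_of_le hT2 hx)).2
        omega, hc1, hc2]
    ring

/-- Splitting a multiset into small blocks with zero sum and a bounded remainder. -/
theorem exists_zero_sum_blocks {ι : Type} (f : ι → ℤ) (K S : ℕ) (L : Multiset ι)
    (hK : ∀ x ∈ L, |f x| ≤ K) (hS : |(L.map f).sum| ≤ S) :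
    ∃ (R : Multiset ι) (Bs : Multiset (Multiset ι)), R + Bs.join = L ∧
      Multiset.card R ≤ S + K * (K * K) + K * K ∧
      ∀ B ∈ Bs, Multiset.card B ≤ 2 * K + 1 ∧ (B.map f).sum = 0 := by
  induction hn : Multiset.card L using Nat.strong_induction_on generalizing L with
  | _ n ih =>
    by_cases hc : Multiset.card L ≤ S + K * (K * K) + K * K
    · exact ⟨L, 0, by simp, hc, by simp⟩
    · push Not at hc
      obtain ⟨T, hTL, hT0, hTc, hTs⟩ := exists_zero_sum_block f K S L hK hS hc
      obtain ⟨L', rfl⟩ := Multiset.le_iff_exists_add.1 hTL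
      have hpos := Multiset.card_pos.2 hT0
      rw [Multiset.card_add] at hn
      rw [Multiset.map_add, Multiset.sum_add, hTs, zero_add] at hS
      obtain ⟨R, Bs, h1, h2, h3⟩ := ih (Multiset.card L') (by omega) L'
        (fun x hx => hK x (by simp [hx])) hS rfl
      refine ⟨R, T ::ₘ Bs, ?_, h2, ?_⟩
      · rw [Multiset.join_cons, ← h1]; abel
      · intro B hB
        rcases Multiset.mem_cons.1 hB with rfl | hB
        · exact ⟨hTc, hTs⟩
        · exact h3 B hB

/-- The size to which a zero-sum reduction in dimension `k` leads. -/
def zeroSumBound : ℕ → ℕ → ℕ → ℕ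
  | 0, _, _ => 0
  | k + 1, K, S => (S + K * (K * K) + K * K) +
      (2 * K + 1) * zeroSumBound k ((2 * K + 1) * K) (S + (S + K * (K * K) + K * K) * K)

theorem Multiset.abs_sum_map_le {ι : Type} (f : ι → ℤ) (K : ℕ) (M : Multiset ι)
    (hf : ∀ x ∈ M, |f x| ≤ K) : |(M.map f).sum| ≤ (Multiset.card M * K : ℕ) := by
  induction M using Multiset.induction_on with
  | empty => simp
  | cons a M ih =>
    have h1 := hf a (by simp)
    have h2 := ih fun x hx => hf x (by simp [hx])
    simp only [Multiset.card_cons, Multiset.map_cons, Multiset.sum_cons]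
    push_cast at *
    have := abs_add_le (f a) (M.map f).sum
    linarith

theorem Multiset.sum_map_join {ι : Type} (f : ι → ℤ) (Bs : Multiset (Multiset ι)) :
    (Bs.join.map f).sum = (Bs.map fun B => (B.map f).sum).sum := by
  simp [Multiset.map_join, Multiset.sum_join]

theorem exists_small_same_sum (k : ℕ) : ∀ {ι : Type} (K S : ℕ) (val : ι → Fin k → ℤ)
    (L : Multiset ι), (∀ x ∈ L, ∀ i, |val x i| ≤ K) →
    (∀ i, |(L.map fun x => val x i).sum| ≤ S) →
    ∃ L' ≤ L, (∀ i, (L'.map fun x => val x i).sum = (L.map fun x => val x i).sum) ∧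
      Multiset.card L' ≤ zeroSumBound k K S := by
  induction k with
  | zero => exact fun K S val L _ _ => ⟨0, by simp, fun i => i.elim0, by simp⟩
  | succ k ih =>
    intro ι K S val L hK hS
    obtain ⟨R, Bs, hL, hR, hBs⟩ :=
      exists_zero_sum_blocks (fun x => val x 0) K S L (fun x hx => hK x hx 0) (hS 0)
    subst hL
    obtain ⟨Bs', hle, hsum, hcard⟩ := ih ((2 * K + 1) * K)
      (S + (S + K * (K * K) + K * K) * K)
      (fun (B : Multiset ι) (i : Fin k) => (B.map fun x => val x i.succ).sum) Bs
      (by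
        intro B hB i
        refine (Multiset.abs_sum_map_le _ K B fun x hx => hK x ?_ _).trans ?_
        · exact Multiset.mem_add.2 (Or.inr (Multiset.mem_join.2 ⟨B, hB, hx⟩))
        · exact_mod_cast Nat.mul_le_mul_right _ (hBs B hB).1)
      (by
        intro i
        have h1 := hS i.succ
        have h2 := Multiset.abs_sum_map_le (fun x => val x i.succ) K R
          fun x hx => hK x (Multiset.mem_add.2 (Or.inl hx)) _
        have h3 : ((Multiset.card R * K : ℕ) : ℤ) ≤ ((S + K * (K * K) + K * K) * K : ℕ) := by
          exact_mod_cast Nat.mul_le_mul_right _ hR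
        rw [Multiset.map_add, Multiset.sum_add, Multiset.sum_map_join] at h1
        rw [Nat.cast_add]
        rw [abs_le] at *
        constructor <;> linarith)
    obtain ⟨Cs, rfl⟩ := Multiset.le_iff_exists_add.1 hle
    refine ⟨R + Bs'.join, ?_, ?_, ?_⟩
    · rw [Multiset.join_add]
      exact add_le_add_right (Multiset.le_add_right _ _) _
    · intro i
      rw [Multiset.map_add, Multiset.sum_add, Multiset.map_add, Multiset.sum_add,
        Multiset.sum_map_join, Multiset.sum_map_join]
      congr 1
      refine Fin.cases ?_ (fun j => hsum j) i
      have hz : ∀ Ds ≤ Bs' + Cs, (Ds.map fun B => (B.map fun x => val x 0).sum).sum = 0 :=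
        fun Ds hD => Multiset.sum_eq_zero fun y hy => by
          obtain ⟨B, hB, rfl⟩ := Multiset.mem_map.1 hy
          exact (hBs B (Multiset.mem_of_le hD hB)).2
      rw [hz _ hle, hz _ le_rfl]
    · rw [Multiset.card_add, zeroSumBound, Multiset.card_join]
      refine Nat.add_le_add hR ?_
      have := Multiset.sum_le_card_nsmul (Bs'.map Multiset.card) (2 * K + 1) (by
        intro y hy
        obtain ⟨B, hB, rfl⟩ := Multiset.mem_map.1 hy
        exact (hBs B (Multiset.mem_of_le hle hB)).1)
      rw [Multiset.card_map, smul_eq_mul, mul_comm] at this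
      exact this.trans (Nat.mul_le_mul_left _ hcard)

/-- `VWalk R s t l U x`: in the graph with edge relation `R`, whose edges carry vectors, there is
a walk of length `l` from `s` to `t` whose set of visited vertices is `U` and whose vectors sum
to `x`. -/
inductive VWalk {V : Type} {k : ℕ} (R : V → V → (Fin k → ℤ) → Prop) :
    V → V → ℕ → Finset V → (Fin k → ℤ) → Prop
  | nil (s : V) : VWalk R s s 0 {s} 0
  | snoc {s t u : V} {l : ℕ} {U : Finset V} {x y : Fin k → ℤ} (h : VWalk R s t l U x)
      (e : R t u y) : VWalk R s u (l + 1) (insert u U) (x + y)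

namespace VWalk

variable {V : Type} {k : ℕ} {R : V → V → (Fin k → ℤ) → Prop}

theorem left_mem {s t : V} {l : ℕ} {U : Finset V} {x : Fin k → ℤ} (h : VWalk R s t l U x) :
    s ∈ U := by
  induction h with
  | nil => simp
  | snoc h e ih => exact Finset.mem_insert_of_mem ih

theorem right_mem {s t : V} {l : ℕ} {U : Finset V} {x : Fin k → ℤ} (h : VWalk R s t l U x) :
    t ∈ U := by
  cases h with
  | nil => simp
  | snoc h e => simp

theorem card_le {s t : V} {l : ℕ} {U : Finset V} {x : Fin k → ℤ} (h : VWalk R s t l U x) :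
    U.card ≤ l + 1 := by
  induction h with
  | nil => simp
  | snoc h e ih => exact (Finset.card_insert_le _ _).trans (by omega)

theorem subset {Ω : Finset V} (hR : ∀ u v y, R u v y → v ∈ Ω) {s t : V} {l : ℕ} {U : Finset V}
    {x : Fin k → ℤ} (h : VWalk R s t l U x) (hs : s ∈ Ω) : U ⊆ Ω := by
  induction h with
  | nil => simpa using hs
  | snoc h e ih => exact Finset.insert_subset (hR _ _ _ e) ih

theorem abs_le {K : ℕ} (hR : ∀ u v y, R u v y → ∀ i, |y i| ≤ K) {s t : V} {l : ℕ}
    {U : Finset V} {x : Fin k → ℤ} (h : VWalk R s t l U x) (i : Fin k) :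
    |x i| ≤ (l * K : ℕ) := by
  induction h with
  | nil => simp
  | @snoc t u l U x y h e ih =>
    have h1 := hR _ _ _ e i
    have h2 := abs_add_le (x i) (y i)
    push_cast at *
    rw [Pi.add_apply]
    linarith

theorem trans {s t u : V} {l l' : ℕ} {U U' : Finset V} {x x' : Fin k → ℤ}
    (h : VWalk R s t l U x) (h' : VWalk R t u l' U' x') :
    VWalk R s u (l + l') (U ∪ U') (x + x') := by
  induction h' with
  | nil =>
    have : U ∪ {t} = U := Finset.union_eq_left.2 (by simpa using h.right_mem)
    rw [this]
    simpa using h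
  | snoc h' e ih =>
    rw [Finset.union_insert, ← add_assoc, ← add_assoc]
    exact ih.snoc e

theorem split {s t v : V} {l : ℕ} {U : Finset V} {x : Fin k → ℤ} (h : VWalk R s t l U x)
    (hv : v ∈ U) : ∃ l₁ l₂ U₁ U₂ x₁ x₂, VWalk R s v l₁ U₁ x₁ ∧ VWalk R v t l₂ U₂ x₂ ∧
      l = l₁ + l₂ ∧ U = U₁ ∪ U₂ ∧ x = x₁ + x₂ := by
  induction h with
  | nil =>
    obtain rfl := Finset.mem_singleton.1 hv
    exact ⟨0, 0, _, _, 0, 0, .nil _, .nil _, rfl, by simp, by simp⟩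
  | @snoc t u l U x y h e ih =>
    by_cases hvu : v = u
    · subst hvu
      exact ⟨_, 0, _, {v}, _, 0, h.snoc e, .nil _, rfl, by simp, by simp⟩
    · obtain ⟨l₁, l₂, U₁, U₂, x₁, x₂, h₁, h₂, rfl, rfl, rfl⟩ :=
        ih ((Finset.mem_insert.1 hv).resolve_left hvu)
      exact ⟨_, _, _, _, _, _, h₁, h₂.snoc e, by omega, by simp, by abel⟩

theorem insert_cycle {s t v : V} {l l' : ℕ} {U U' : Finset V} {x x' : Fin k → ℤ}
    (h : VWalk R s t l U x) (hv : v ∈ U) (h' : VWalk R v v l' U' x') :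
    VWalk R s t (l + l') (U ∪ U') (x + x') := by
  obtain ⟨l₁, l₂, U₁, U₂, x₁, x₂, h₁, h₂, rfl, rfl, rfl⟩ := h.split hv
  convert (h₁.trans h').trans h₂ using 1
  · omega
  · ext; simp; tauto
  · abel

theorem insert_cycles {n : ℕ} {s t : V} (C : Multiset (Fin k → ℤ)) {l : ℕ} {U : Finset V}
    {x : Fin k → ℤ} (h : VWalk R s t l U x)
    (hC : ∀ z ∈ C, ∃ u ∈ U, ∃ l ≤ n, ∃ U', VWalk R u u l U' z) :
    ∃ l' ≤ l + n * Multiset.card C, ∃ U', VWalk R s t l' U' (x + C.sum) := by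
  induction C using Multiset.induction_on generalizing l U x with
  | empty => exact ⟨l, by simp, U, by simpa using h⟩
  | cons z C ih =>
    obtain ⟨u, hu, l₁, hl₁, U₁, h₁⟩ := hC z (by simp)
    obtain ⟨l', hl', U', h'⟩ := ih (h.insert_cycle hu h₁) fun z hz => by
      obtain ⟨u, hu, h⟩ := hC z (by simp [hz])
      exact ⟨u, Finset.mem_union_left _ hu, h⟩
    refine ⟨l', ?_, U', ?_⟩
    · rw [Multiset.card_cons, mul_add]; omega
    · rwa [Multiset.sum_cons, ← add_assoc]

/-- Every walk in a graph with at most `n` vertices splits into a short walk and a family of short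
cycles based at vertices of that short walk. -/
theorem exists_decomposition {n : ℕ} {Ω : Finset V} (hn : Ω.card ≤ n)
    (hR : ∀ u v y, R u v y → v ∈ Ω) {s t : V} {l : ℕ} {U : Finset V} {x : Fin k → ℤ}
    (h : VWalk R s t l U x) (hs : s ∈ Ω) :
    ∃ y la A xa lg G xg, ∃ C : Multiset (Fin k → ℤ), VWalk R s y la A xa ∧ VWalk R y t lg G xg ∧
      G.card = lg + 1 ∧ G ⊆ A ∧ la + n ≤ A.card * n ∧
      (∀ z ∈ C, ∃ u ∈ A, ∃ l ≤ n, ∃ U', VWalk R u u l U' z) ∧ x = xa + xg + C.sum := by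
  induction h with
  | nil => exact ⟨s, 0, {s}, 0, 0, {s}, 0, 0, .nil _, .nil _, by simp, by simp, by simp,
      by simp, by simp⟩
  | @snoc t u l U x w h e ih =>
    obtain ⟨y, la, A, xa, lg, G, xg, C, ha, hg, hG, hGA, hla, hC, rfl⟩ := ih
    have hAΩ := ha.subset hR hs
    have hGn : G.card ≤ n := (Finset.card_le_card (hGA.trans hAΩ)).trans hn
    by_cases huA : u ∈ A
    · by_cases huG : u ∈ G
      · obtain ⟨l₁, l₂, U₁, U₂, x₁, x₂, h₁, h₂, rfl, rfl, rfl⟩ := hg.split huG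
        refine ⟨y, la, A, xa, l₁, U₁, x₁, (x₂ + w) ::ₘ C, ha, h₁, ?_,
          Finset.subset_union_left.trans hGA, hla, ?_, ?_⟩
        · have c1 := h₁.card_le
          have c2 := h₂.card_le
          have c3 := Finset.card_union_add_card_inter U₁ U₂
          have c4 : 0 < (U₁ ∩ U₂).card :=
            Finset.card_pos.2 ⟨u, Finset.mem_inter.2 ⟨h₁.right_mem, h₂.left_mem⟩⟩
          omega
        · intro z hz
          rcases Multiset.mem_cons.1 hz with rfl | hz
          · exact ⟨u, huA, l₂ + 1, by omega, _, h₂.snoc e⟩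
          · exact hC z hz
        · rw [Multiset.sum_cons]; abel
      · refine ⟨y, la, A, xa, _, _, _, C, ha, hg.snoc e, ?_, ?_, hla, hC, by abel⟩
        · rw [Finset.card_insert_of_notMem huG, hG]
        · exact Finset.insert_subset huA hGA
    · refine ⟨u, _, _, _, 0, {u}, 0, C, (ha.trans hg).snoc e, .nil u, by simp, by simp, ?_, ?_,
        by abel⟩
      · rw [Finset.union_eq_left.2 hGA, Finset.card_insert_of_notMem huA, add_mul]
        omega
      · intro z hz
        obtain ⟨v, hv, h⟩ := hC z hz
        exact ⟨v, by simp [hv], h⟩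

end VWalk

/-- A length bound for shortest zero-sum walks in graphs with `n` vertices and with edge vectors in
`[-K, K]^k`. -/
def walkBound (k n K : ℕ) : ℕ := n * n + n * zeroSumBound k (n * K) (n * n * K)

theorem VWalk.exists_short {V : Type} {k : ℕ} {R : V → V → (Fin k → ℤ) → Prop} {n K : ℕ}
    {Ω : Finset V} (hn : Ω.card ≤ n) (hR : ∀ u v y, R u v y → v ∈ Ω)
    (hK : ∀ u v y, R u v y → ∀ i, |y i| ≤ K) {s t : V} {l : ℕ} {U : Finset V}
    (h : VWalk R s t l U 0) (hs : s ∈ Ω) :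
    ∃ l' ≤ walkBound k n K, ∃ U', VWalk R s t l' U' 0 := by
  obtain ⟨y, la, A, xa, lg, G, xg, C, ha, hg, hG, hGA, hla, hC, hx⟩ :=
    h.exists_decomposition hn hR hs
  have hAn : A.card ≤ n := (Finset.card_le_card (ha.subset hR hs)).trans hn
  have hGn := (Finset.card_le_card hGA).trans hAn
  have hln : la + lg ≤ n * n := by
    have := Nat.mul_le_mul_right n hAn
    omega
  have hw := ha.trans hg
  have hsumC : ∀ D : Multiset (Fin k → ℤ), ∀ i, (D.map fun z => z i).sum = D.sum i :=
    fun D i => (Multiset.sum_hom D (Pi.evalAddMonoidHom (fun _ : Fin k => ℤ) i))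
  obtain ⟨C', hle, hsum, hcard⟩ := exists_small_same_sum k (n * K) (n * n * K)
    (fun z : Fin k → ℤ => z) C
    (by
      intro z hz i
      obtain ⟨u, hu, l, hl, U', hc⟩ := hC z hz
      exact (hc.abs_le hK i).trans (by exact_mod_cast Nat.mul_le_mul_right _ hl))
    (by
      intro i
      have h1 := hw.abs_le hK i
      have h2 := congrFun hx i
      rw [hsumC]
      rw [Pi.add_apply, Pi.zero_apply] at h2
      have h3 : C.sum i = - ((xa + xg) i) := by linarith
      rw [h3, abs_neg]
      exact h1.trans (by exact_mod_cast Nat.mul_le_mul_right _ hln))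
  have hC' : C'.sum = C.sum := funext fun i => by rw [← hsumC, ← hsumC]; exact hsum i
  obtain ⟨l', hl', U', h'⟩ := hw.insert_cycles (n := n) C' fun z hz => by
    obtain ⟨u, hu, h⟩ := hC z (Multiset.mem_of_le hle hz)
    exact ⟨u, Finset.mem_union_left _ hu, h⟩
  rw [hC', ← hx] at h'
  refine ⟨l', hl'.trans ?_, U', h'⟩
  exact Nat.add_le_add hln (Nat.mul_le_mul_left _ hcard)

/-- The vector of length `k` encoded by a list. -/
def listVec (k : ℕ) (l : List ℤ) : Fin k → ℤ := fun i => l.getD i 0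

/-- A configuration: state, register, number of nonzero vectors used so far. -/
abbrev Config (k : ℕ) : Type := ℕ × (Fin k → ℤ) × ℕ

/-- The configuration reached from `x` by the transition `e`. -/
def stepConfig (k : ℕ) (d : EFAData) (x : Config k) (e : ℕ × Bool × ℕ × List ℤ) : Config k :=
  (e.2.2.1 % (d.1 + 1), x.2.1 + listVec k e.2.2.2,
    if listVec k e.2.2.2 = 0 then x.2.2 else x.2.2 + 1)

/-- The configurations reached from those in `X` by reading the letter `a`. -/
def reachStep (k : ℕ) (d : EFAData) (X : List (Config k)) (a : Bool) : List (Config k) :=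
  X.flatMap fun x =>
    d.2.1.flatMap fun e => if e.1 = x.1 ∧ e.2.1 = a then [stepConfig k d x e] else []

/-- The configurations reached from the initial one by reading the word `w`. -/
def reach (k : ℕ) (d : EFAData) (w : List Bool) : List (Config k) :=
  w.foldl (reachStep k d) [(0, 0, 0)]

theorem mem_reach_nil {k : ℕ} {d : EFAData} {y : Config k} :
    y ∈ reach k d [] ↔ y = (0, 0, 0) := by
  simp [reach]

theorem mem_reach_concat {k : ℕ} {d : EFAData} {w : List Bool} {a : Bool} {y : Config k} :
    y ∈ reach k d (w ++ [a]) ↔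
      ∃ x ∈ reach k d w, ∃ e ∈ d.2.1, e.1 = x.1 ∧ e.2.1 = a ∧ y = stepConfig k d x e := by
  rw [reach, List.foldl_append]
  simp only [List.foldl_cons, List.foldl_nil, reachStep, List.mem_flatMap]
  refine exists_congr fun x => and_congr Iff.rfl (exists_congr fun e => and_congr Iff.rfl ?_)
  split_ifs with h
  · simp [h]
  · simp only [List.not_mem_nil, false_iff]
    tauto

theorem Encodable.encode_le_of_mem {α : Type} [Encodable α] {l : List α} {a : α} (h : a ∈ l) :
    Encodable.encode a ≤ Encodable.encode l := by
  induction l with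
  | nil => simp at h
  | cons b l ih =>
    rw [Encodable.encode_list_cons]
    rcases List.mem_cons.1 h with rfl | h
    · exact (Nat.left_le_pair _ _).trans (Nat.le_succ _)
    · exact (ih h).trans ((Nat.right_le_pair _ _).trans (Nat.le_succ _))

theorem Encodable.encode_int_ofNat (n : ℕ) : Encodable.encode (n : ℤ) = 2 * n := rfl

theorem Encodable.encode_int_negSucc (n : ℕ) :
    Encodable.encode (Int.negSucc n) = 2 * n + 1 := rfl

theorem Encodable.natAbs_le_encode (z : ℤ) : z.natAbs ≤ Encodable.encode z := by
  cases z with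
  | ofNat n => rw [Int.ofNat_eq_natCast, Encodable.encode_int_ofNat]; simp; omega
  | negSucc n => rw [Encodable.encode_int_negSucc, Int.natAbs_negSucc]; omega

theorem EFAData.card_le_encode (d : EFAData) : d.1 ≤ Encodable.encode d :=
  Nat.left_le_pair d.1 (Encodable.encode d.2)

theorem abs_listVec_le {k : ℕ} {d : EFAData} {e : ℕ × Bool × ℕ × List ℤ} (he : e ∈ d.2.1)
    (i : Fin k) : |listVec k e.2.2.2 i| ≤ Encodable.encode d := by
  have hd : Encodable.encode d.2.1 ≤ Encodable.encode d :=
    (Nat.left_le_pair _ (Encodable.encode d.2.2)).trans (Nat.right_le_pair d.1 _)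
  have h1 : Encodable.encode e.2.2.2 ≤ Encodable.encode e :=
    (Nat.right_le_pair e.2.2.1 _).trans
      ((Nat.right_le_pair (Encodable.encode e.2.1) _).trans (Nat.right_le_pair e.1 _))
  rw [listVec, List.getD_eq_getElem?_getD]
  cases h : e.2.2.2[(i : ℕ)]? with
  | none => simp
  | some z =>
    have h2 := Encodable.encode_le_of_mem (List.mem_of_getElem? h)
    have h3 := Encodable.natAbs_le_encode z
    have h4 := Encodable.encode_le_of_mem he
    rw [Int.abs_eq_natAbs, Option.getD_some]
    exact_mod_cast h3.trans (h2.trans (h1.trans (h4.trans hd)))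

theorem reach_bounds {k : ℕ} {d : EFAData} {w : List Bool} {x : Config k} (h : x ∈ reach k d w) :
    x.1 ≤ Encodable.encode d ∧ ∀ i, |x.2.1 i| ≤ (x.2.2 * Encodable.encode d : ℕ) := by
  induction w using List.reverseRecOn generalizing x with
  | nil => rw [mem_reach_nil] at h; subst h; simp
  | append_singleton w a ih =>
    obtain ⟨x, hx, e, he, -, -, rfl⟩ := mem_reach_concat.1 h
    refine ⟨(Nat.lt_succ_iff.1 (Nat.mod_lt _ (Nat.succ_pos _))).trans d.card_le_encode,
      fun i => ?_⟩
    have h1 := (ih hx).2 i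
    have h2 := abs_listVec_le (k := k) he i
    simp only [stepConfig, Pi.add_apply]
    split_ifs with h0
    · simpa [h0] using h1
    · have h3 := abs_add_le (x.2.1 i) (listVec k e.2.2.2 i)
      push_cast at *
      linarith

/-- The configurations with bounded state, bounded register and counter at most `c`. -/
noncomputable def boundedConfigs (k c N : ℕ) : Finset (Config k) :=
  Finset.range (N + 1) ×ˢ
    (Fintype.piFinset fun _ : Fin k => Finset.Icc (-((c * N : ℕ) : ℤ)) ((c * N : ℕ) : ℤ)) ×ˢ
      Finset.range (c + 1)

theorem card_boundedConfigs (k c N : ℕ) :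
    (boundedConfigs k c N).card = (N + 1) * ((2 * (c * N) + 1) ^ k * (c + 1)) := by
  have : ((c * N : ℕ) + 1 - -((c * N : ℕ) : ℤ)).toNat = 2 * (c * N) + 1 := by omega
  rw [boundedConfigs, Finset.card_product, Finset.card_product, Fintype.card_piFinset_const,
    Int.card_Icc, this, Finset.card_range, Finset.card_range]

theorem mem_boundedConfigs_of_mem_reach {k c : ℕ} {d : EFAData} {w : List Bool} {x : Config k}
    (h : x ∈ reach k d w) (hc : x.2.2 ≤ c) : x ∈ boundedConfigs k c (Encodable.encode d) := by
  obtain ⟨h1, h2⟩ := reach_bounds h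
  simp only [boundedConfigs, Finset.mem_product, Finset.mem_range, Fintype.mem_piFinset,
    Finset.mem_Icc]
  refine ⟨by omega, fun i => ?_, by omega⟩
  rw [← abs_le]
  exact (h2 i).trans (by exact_mod_cast Nat.mul_le_mul_right _ hc)

theorem le_of_mem_boundedConfigs {k c N : ℕ} {x : Config k} (h : x ∈ boundedConfigs k c N) : x.2.2 ≤ c := by
  simp only [boundedConfigs, Finset.mem_product, Finset.mem_range] at h
  omega

/-- The configurations with counter at most `c` reached by reading `w`. -/
noncomputable def lowReach (k c : ℕ) (d : EFAData) (w : List Bool) : Finset (Config k) :=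
  (boundedConfigs k c (Encodable.encode d)).filter fun x => x ∈ reach k d w

/-- The effect of a letter on the set `lowReach`. -/
noncomputable def lowStep (k c : ℕ) (d : EFAData) (D : Finset (Config k)) (a : Bool) :
    Finset (Config k) :=
  (boundedConfigs k c (Encodable.encode d)).filter fun y =>
    ∃ x ∈ D, ∃ e ∈ d.2.1, e.1 = x.1 ∧ e.2.1 = a ∧ y = stepConfig k d x e

theorem mem_lowReach {k c : ℕ} {d : EFAData} {w : List Bool} {x : Config k} :
    x ∈ lowReach k c d w ↔ x ∈ reach k d w ∧ x.2.2 ≤ c := by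
  rw [lowReach, Finset.mem_filter]
  exact ⟨fun h => ⟨h.2, le_of_mem_boundedConfigs h.1⟩,
    fun h => ⟨mem_boundedConfigs_of_mem_reach h.1 h.2, h.1⟩⟩

theorem lowReach_concat (k c : ℕ) (d : EFAData) (w : List Bool) (a : Bool) :
    lowReach k c d (w ++ [a]) = lowStep k c d (lowReach k c d w) a := by
  ext y
  rw [lowReach, lowStep, Finset.mem_filter, Finset.mem_filter, mem_reach_concat]
  refine and_congr_right fun hy => exists_congr fun x => ?_
  rw [mem_lowReach]
  constructor
  · rintro ⟨hx, e, he, h1, h2, rfl⟩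
    refine ⟨⟨hx, ?_⟩, e, he, h1, h2, rfl⟩
    have := le_of_mem_boundedConfigs hy
    simp only [stepConfig] at this
    split_ifs at this <;> omega
  · rintro ⟨⟨hx, -⟩, h⟩
    exact ⟨hx, h⟩

/-- The edges of the product of the automaton with the determinized automaton of computations
using at most `c` nonzero vectors. -/
def ProdEdge (k c : ℕ) (d : EFAData) (u v : ℕ × Finset (Config k)) (y : Fin k → ℤ) : Prop :=
  ∃ e ∈ d.2.1, e.1 = u.1 ∧ v = (e.2.2.1 % (d.1 + 1), lowStep k c d u.2 e.2.1) ∧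
    y = listVec k e.2.2.2

theorem exists_walk_of_mem_reach {k c : ℕ} {d : EFAData} {w : List Bool} {x : Config k}
    (h : x ∈ reach k d w) :
    ∃ U, VWalk (ProdEdge k c d) (0, lowReach k c d []) (x.1, lowReach k c d w) w.length U x.2.1 := by
  induction w using List.reverseRecOn generalizing x with
  | nil => rw [mem_reach_nil] at h; subst h; exact ⟨_, .nil _⟩
  | append_singleton w a ih =>
    obtain ⟨x, hx, e, he, h1, rfl, rfl⟩ := mem_reach_concat.1 h
    obtain ⟨U, hU⟩ := ih hx
    rw [List.length_append, lowReach_concat]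
    exact ⟨_, hU.snoc ⟨e, he, h1, rfl, rfl⟩⟩

theorem exists_mem_reach_of_walk {k c : ℕ} {d : EFAData} {v : ℕ × Finset (Config k)} {l : ℕ}
    {U : Finset (ℕ × Finset (Config k))} {x : Fin k → ℤ}
    (h : VWalk (ProdEdge k c d) (0, lowReach k c d []) v l U x) :
    ∃ w : List Bool, w.length = l ∧ v.2 = lowReach k c d w ∧ ∃ j, (v.1, x, j) ∈ reach k d w := by
  induction h with
  | nil => exact ⟨[], rfl, rfl, 0, mem_reach_nil.2 rfl⟩
  | snoc h e ih =>
    obtain ⟨w, rfl, hw, j, hj⟩ := ih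
    obtain ⟨e, he, h1, rfl, rfl⟩ := e
    exact ⟨w ++ [e.2.1], by simp, by rw [lowReach_concat, hw], _,
      mem_reach_concat.2 ⟨_, hj, e, he, h1, rfl, rfl⟩⟩

/-- Configurations in a final state with zero register. -/
def AcceptingConfig (k : ℕ) (d : EFAData) (x : Config k) : Prop := x.1 ∈ d.2.2 ∧ x.2.1 = 0

/-- A word all of whose accepting computations (if any) can be replaced by one using at most `c`
nonzero vectors. -/
def LowWord (k c : ℕ) (d : EFAData) (w : List Bool) : Prop :=
  (∃ x ∈ reach k d w, AcceptingConfig k d x) →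
    ∃ x ∈ reach k d w, AcceptingConfig k d x ∧ x.2.2 ≤ c

/-- A bound for the length of a shortest word violating `LowWord`. -/
def wordBound (k c N : ℕ) : ℕ :=
  walkBound k ((N + 1) * 2 ^ ((N + 1) * ((2 * (c * N) + 1) ^ k * (c + 1)))) N

theorem lowWord_of_short {k c : ℕ} {d : EFAData}
    (h : ∀ w : List Bool, w.length ≤ wordBound k c (Encodable.encode d) → LowWord k c d w)
    (w : List Bool) : LowWord k c d w := by
  rintro ⟨⟨q, _, j⟩, hx, hF, rfl⟩
  obtain ⟨U, hU⟩ := exists_walk_of_mem_reach (c := c) hx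
  obtain ⟨l', hl', U', hU'⟩ := hU.exists_short
    (Ω := Finset.range (Encodable.encode d + 1) ×ˢ (boundedConfigs k c (Encodable.encode d)).powerset)
    (n := (Encodable.encode d + 1) *
      2 ^ ((Encodable.encode d + 1) * ((2 * (c * Encodable.encode d) + 1) ^ k * (c + 1))))
    (K := Encodable.encode d)
    (by rw [Finset.card_product, Finset.card_powerset, card_boundedConfigs, Finset.card_range])
    (by
      rintro u v y ⟨e, he, -, rfl, -⟩
      rw [Finset.mem_product, Finset.mem_range, Finset.mem_powerset]
      exact ⟨(Nat.mod_lt _ (Nat.succ_pos _)).trans_le (Nat.succ_le_succ d.card_le_encode),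
        Finset.filter_subset _ _⟩)
    (by
      rintro u v y ⟨e, he, -, -, rfl⟩ i
      exact abs_listVec_le he i)
    (by
      rw [Finset.mem_product, Finset.mem_range, Finset.mem_powerset]
      exact ⟨Nat.succ_pos _, Finset.filter_subset _ _⟩)
  obtain ⟨w', rfl, hw', j', hj'⟩ := exists_mem_reach_of_walk hU'
  obtain ⟨x, hx, hacc, hxc⟩ := h w' hl' ⟨_, hj', hF, rfl⟩
  have hxw : x ∈ lowReach k c d w := by
    rw [show lowReach k c d w = lowReach k c d w' from hw']
    exact mem_lowReach.2 ⟨hx, hxc⟩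
  exact ⟨x, (mem_lowReach.1 hxw).1, hacc, hxc⟩

theorem reach_steps {k : ℕ} {d : EFAData} {w : List Bool} {x : Config k}
    (h : x ∈ reach k d w) (hq : x.1 < d.1 + 1) (v : List Bool)
    (c : Fin (d.1 + 1) × List Bool × Multiplicative (Fin k → ℤ)) (j : ℕ)
    (hs : (toEFA k d).Steps ((⟨x.1, hq⟩ : Fin (d.1 + 1)), v, Multiplicative.ofAdd x.2.1) c j) :
    (toEFA k d).Steps ((toEFA k d).q₀, w ++ v, 1) c (x.2.2 + j) := by
  induction w using List.reverseRecOn generalizing x v j with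
  | nil =>
    rw [mem_reach_nil] at h
    subst h
    rw [zero_add]
    exact hs
  | append_singleton w a ih =>
    obtain ⟨x, hx, e, he, h1, rfl, rfl⟩ := mem_reach_concat.1 h
    have hq' : x.1 < d.1 + 1 := by
      induction w using List.reverseRecOn with
      | nil => rw [mem_reach_nil] at hx; subst hx; simp
      | append_singleton w a _ =>
        obtain ⟨x, hx, e, he, h1, rfl, rfl⟩ := mem_reach_concat.1 hx
        exact Nat.mod_lt _ (Nat.succ_pos _)
    have hst := EFA.Steps.step (A := toEFA k d) (q := (⟨x.1, hq'⟩ : Fin (d.1 + 1)))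
      (a := e.2.1) (w := v) (m := Multiplicative.ofAdd x.2.1) (c := c) (k := j)
      (s := (⟨e.2.2.1 % (d.1 + 1), Nat.mod_lt _ (Nat.succ_pos _)⟩ : Fin (d.1 + 1)))
      (r := vecOf k e.2.2.2) ⟨e, ⟨he, h1, rfl⟩, rfl⟩ hs
    have := ih hx hq' _ _ hst
    rw [List.append_assoc, List.singleton_append]
    convert this using 1
    have hz : vecOf k e.2.2.2 = 1 ↔ listVec k e.2.2.2 = 0 := Iff.rfl
    simp only [stepConfig, hz]
    split_ifs <;> omega

theorem steps_reach {k : ℕ} {d : EFAData}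
    {c c' : (toEFA k d).Q × List Bool × Multiplicative (Fin k → ℤ)} {j : ℕ}
    (hs : (toEFA k d).Steps c c' j) (hc' : c'.2.1 = []) (u : List Bool) (i : ℕ)
    (h : (Fin.val (n := d.1 + 1) c.1, c.2.2.toAdd, i) ∈ reach k d u) :
    (Fin.val (n := d.1 + 1) c'.1, c'.2.2.toAdd, i + j) ∈ reach k d (u ++ c.2.1) := by
  induction hs generalizing u i with
  | refl c => simpa [hc'] using h
  | @step s r q w m c j a hδ _ ih =>
    obtain ⟨e, ⟨he, h1, rfl⟩, heq⟩ := hδ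
    obtain ⟨rfl, rfl⟩ := Prod.mk.inj heq
    have := ih hc' (u ++ [e.2.1]) (if listVec k e.2.2.2 = 0 then i else i + 1)
      (mem_reach_concat.2 ⟨_, h, e, he, h1, rfl, rfl⟩)
    rw [List.append_assoc, List.singleton_append] at this
    convert this using 3
    have hz : vecOf k e.2.2.2 = 1 ↔ listVec k e.2.2.2 = 0 := Iff.rfl
    simp only [hz]
    split_ifs <;> omega

theorem acceptsN_iff {k : ℕ} {d : EFAData} {w : List Bool} {j : ℕ} :
    (toEFA k d).AcceptsN w j ↔ ∃ x ∈ reach k d w, AcceptingConfig k d x ∧ x.2.2 = j := by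
  constructor
  · rintro ⟨q, hq, hs⟩
    have := steps_reach hs rfl [] 0 (mem_reach_nil.2 rfl)
    exact ⟨_, this, ⟨hq, rfl⟩, by simp⟩
  · rintro ⟨⟨q, _, j⟩, hx, ⟨hF, rfl⟩, rfl⟩
    have hq : q < d.1 + 1 := by
      induction w using List.reverseRecOn with
      | nil => rw [mem_reach_nil] at hx; simp only [Prod.mk.injEq] at hx; omega
      | append_singleton w a _ =>
        obtain ⟨x, hx, e, he, h1, rfl, hx'⟩ := mem_reach_concat.1 hx
        rw [(Prod.mk.inj hx').1]
        exact Nat.mod_lt _ (Nat.succ_pos _)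
    refine ⟨(⟨q, hq⟩ : Fin (d.1 + 1)), hF, ?_⟩
    have := reach_steps hx hq [] _ 0 (.refl _)
    simpa using this

theorem EFA.gmcW_le_iff {V M : Type} [Group M] (A : EFA V M) (w : List V) (c : ℕ) :
    A.gmcW w ≤ c ↔ ((∃ j, A.AcceptsN w j) → ∃ j ≤ c, A.AcceptsN w j) := by
  constructor
  · exact fun h hne => ⟨_, h, Nat.sInf_mem hne⟩
  · intro h
    by_cases hne : ∃ j, A.AcceptsN w j
    · obtain ⟨j, hj, hw⟩ := h hne
      exact (Nat.sInf_le hw).trans hj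
    · have : {j | A.AcceptsN w j} = ∅ := Set.eq_empty_of_forall_notMem fun j hj => hne ⟨j, hj⟩
      rw [EFA.gmcW, this, Nat.sInf_empty]
      exact Nat.zero_le _

theorem EFA.gmcFun_le_iff {V M : Type} [Finite V] [Group M] (A : EFA V M) (n c : ℕ) :
    A.gmcFun n ≤ c ↔ ∀ w : List V, w.length = n → A.gmcW w ≤ c := by
  have hfin : {m | ∃ w : List V, w.length = n ∧ A.gmcW w = m}.Finite :=
    (List.finite_length_eq V n).image A.gmcW
  constructor
  · exact fun h w hw => (le_csSup hfin.bddAbove ⟨w, hw, rfl⟩).trans h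
  · intro h
    rcases Set.eq_empty_or_nonempty {m | ∃ w : List V, w.length = n ∧ A.gmcW w = m} with he | he
    · rw [EFA.gmcFun, he]; simp
    · exact csSup_le he fun m ⟨w, hw, hm⟩ => hm ▸ h w hw

theorem gmcW_toEFA_le_iff {k c : ℕ} {d : EFAData} {w : List Bool} :
    (toEFA k d).gmcW w ≤ c ↔ LowWord k c d w := by
  rw [EFA.gmcW_le_iff, LowWord]
  simp only [acceptsN_iff]
  refine imp_congr ?_ ?_
  · exact ⟨fun ⟨j, x, hx, h, _⟩ => ⟨x, hx, h⟩, fun ⟨x, hx, h⟩ => ⟨_, x, hx, h, rfl⟩⟩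
  · exact ⟨fun ⟨j, hj, x, hx, h, hxj⟩ => ⟨x, hx, h, hxj ▸ hj⟩,
      fun ⟨x, hx, h, hxc⟩ => ⟨_, hxc, x, hx, h, rfl⟩⟩

theorem forall_gmcFun_le_iff {k c : ℕ} {d : EFAData} :
    (∀ n, (toEFA k d).gmcFun n ≤ c) ↔
      ∀ w : List Bool, w.length ≤ wordBound k c (Encodable.encode d) → LowWord k c d w := by
  simp only [EFA.gmcFun_le_iff, gmcW_toEFA_le_iff]
  exact ⟨fun h w _ => h _ w rfl, fun h n w _ => lowWord_of_short h w⟩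

section Computability

open Primrec

theorem primrec_nat_pow : Primrec₂ ((· ^ ·) : ℕ → ℕ → ℕ) :=
  Primrec₂.unpaired'.1 Nat.Primrec.pow

theorem primrec_zeroSumBound (k : ℕ) : Primrec₂ (zeroSumBound k) := by
  induction k with
  | zero => exact Primrec₂.const 0
  | succ k ih =>
    have hK : Primrec fun p : ℕ × ℕ => p.1 := fst
    have hS : Primrec fun p : ℕ × ℕ => p.2 := snd
    have hr : Primrec fun p : ℕ × ℕ => p.2 + p.1 * (p.1 * p.1) + p.1 * p.1 :=
      nat_add.comp (nat_add.comp hS (nat_mul.comp hK (nat_mul.comp hK hK))) (nat_mul.comp hK hK)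
    have hb : Primrec fun p : ℕ × ℕ => 2 * p.1 + 1 := nat_double_succ.comp hK
    exact nat_add.comp hr (nat_mul.comp hb
      (ih.comp (nat_mul.comp hb hK) (nat_add.comp hS (nat_mul.comp hr hK))))

theorem primrec_wordBound (k c : ℕ) : Primrec (wordBound k c) := by
  have hN : Primrec fun N : ℕ => N + 1 := succ
  have hn : Primrec fun N : ℕ => (N + 1) * 2 ^ ((N + 1) * ((2 * (c * N) + 1) ^ k * (c + 1))) :=
    nat_mul.comp hN (primrec_nat_pow.comp (const 2) (nat_mul.comp hN (nat_mul.comp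
      (primrec_nat_pow.comp (nat_double_succ.comp (nat_mul.comp (const c) Primrec.id)) (const k))
      (const (c + 1)))))
  have hnn := nat_mul.comp hn hn
  exact nat_add.comp hnn (nat_mul.comp hn ((primrec_zeroSumBound k).comp
    (nat_mul.comp hn Primrec.id) (nat_mul.comp hnn Primrec.id)))

theorem primrec_int_natCast_sub : Primrec₂ fun a b : ℕ => (a : ℤ) - b := by
  refine Primrec₂.encode_iff.1 (Primrec₂.of_eq
    (f := fun a b : ℕ => if b ≤ a then 2 * (a - b) else 2 * (b - a - 1) + 1) ?_ ?_)
  · exact Primrec.ite (nat_le.comp snd fst) (nat_double.comp nat_sub)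
      (nat_double_succ.comp (nat_sub.comp (nat_sub.comp snd fst) (const 1)))
  · intro a b
    split_ifs with h
    · rw [show (a : ℤ) - b = ((a - b : ℕ) : ℤ) by omega]
      rfl
    · rw [show (a : ℤ) - b = Int.negSucc (b - a - 1) by omega]
      rfl

theorem primrec_int_toNat : Primrec Int.toNat := by
  refine Primrec.of_eq (f := fun z : ℤ =>
    if Encodable.encode z % 2 = 0 then Encodable.encode z / 2 else 0) ?_ ?_
  · exact Primrec.ite (Primrec.eq.comp (nat_mod.comp .encode (const 2)) (const 0))
      (nat_div.comp .encode (const 2)) (const 0)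
  · intro z
    cases z with
    | ofNat n => rw [Int.ofNat_eq_natCast, Encodable.encode_int_ofNat]; simp
    | negSucc n => rw [Encodable.encode_int_negSucc, if_neg (by omega), Int.toNat_negSucc]

theorem primrec_int_toNat_neg : Primrec fun z : ℤ => (-z).toNat := by
  refine Primrec.of_eq (f := fun z : ℤ =>
    if Encodable.encode z % 2 = 0 then 0 else Encodable.encode z / 2 + 1) ?_ ?_
  · exact Primrec.ite (Primrec.eq.comp (nat_mod.comp .encode (const 2)) (const 0))
      (const 0) (succ.comp (nat_div.comp .encode (const 2)))
  · intro z
    cases z with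
    | ofNat n => rw [Int.ofNat_eq_natCast, Encodable.encode_int_ofNat]; simp
    | negSucc n =>
      rw [Encodable.encode_int_negSucc, if_neg (by omega), Int.neg_negSucc, Int.toNat_natCast]
      omega

theorem primrec_int_add : Primrec₂ ((· + ·) : ℤ → ℤ → ℤ) := by
  refine Primrec₂.of_eq (f := fun a b : ℤ =>
    ((a.toNat + b.toNat : ℕ) : ℤ) - ((-a).toNat + (-b).toNat : ℕ)) ?_ (fun a b => by omega)
  exact primrec_int_natCast_sub.comp
    (nat_add.comp (primrec_int_toNat.comp fst) (primrec_int_toNat.comp snd))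
    (nat_add.comp (primrec_int_toNat_neg.comp fst) (primrec_int_toNat_neg.comp snd))

theorem primrec_listVec (k : ℕ) : Primrec (listVec k) :=
  fin_curry.2 ((list_getD (0 : ℤ)).comp fst (fin_val.comp snd))

theorem primrec_vec_add (k : ℕ) :
    Primrec₂ ((· + ·) : (Fin k → ℤ) → (Fin k → ℤ) → (Fin k → ℤ)) :=
  fin_curry.2 (primrec_int_add.comp (fin_app.comp (fst.comp fst) snd)
    (fin_app.comp (snd.comp fst) snd))

theorem primrec_stepConfig (k : ℕ) :
    Primrec fun p : EFAData × Config k × (ℕ × Bool × ℕ × List ℤ) =>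
      stepConfig k p.1 p.2.1 p.2.2 := by
  have hx : Primrec fun p : EFAData × Config k × (ℕ × Bool × ℕ × List ℤ) => p.2.1 :=
    fst.comp snd
  have he : Primrec fun p : EFAData × Config k × (ℕ × Bool × ℕ × List ℤ) => p.2.2.2.2 :=
    snd.comp (snd.comp (snd.comp snd))
  have hv := (primrec_listVec k).comp (snd.comp he)
  have hj := snd.comp (snd.comp hx)
  exact Primrec.pair (nat_mod.comp (fst.comp he) (succ.comp (fst.comp fst)))
    (Primrec.pair ((primrec_vec_add k).comp (fst.comp (snd.comp hx)) hv)
      (Primrec.ite (Primrec.eq.comp hv (const 0)) hj (succ.comp hj)))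

theorem primrec_reachStep (k : ℕ) :
    Primrec fun p : EFAData × List (Config k) × Bool => reachStep k p.1 p.2.1 p.2.2 := by
  have hd : Primrec fun p : ((EFAData × List (Config k) × Bool) × Config k) ×
      (ℕ × Bool × ℕ × List ℤ) => p.1.1.1 := fst.comp (fst.comp fst)
  have ha : Primrec fun p : ((EFAData × List (Config k) × Bool) × Config k) ×
      (ℕ × Bool × ℕ × List ℤ) => p.1.1.2.2 := snd.comp (snd.comp (fst.comp fst))
  have hx : Primrec fun p : ((EFAData × List (Config k) × Bool) × Config k) ×
      (ℕ × Bool × ℕ × List ℤ) => p.1.2 := snd.comp fst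
  have he : Primrec fun p : ((EFAData × List (Config k) × Bool) × Config k) ×
      (ℕ × Bool × ℕ × List ℤ) => p.2 := snd
  have hstep := (primrec_stepConfig k).comp (hd.pair (hx.pair he))
  have hs : Primrec fun p : ((EFAData × List (Config k) × Bool) × Config k) ×
      (ℕ × Bool × ℕ × List ℤ) => [stepConfig k p.1.1.1 p.1.2 p.2] :=
    list_cons.comp hstep (const [])
  have hcond : PrimrecPred fun p : ((EFAData × List (Config k) × Bool) × Config k) ×
      (ℕ × Bool × ℕ × List ℤ) => p.2.1 = p.1.2.1 ∧ p.2.2.1 = p.1.1.2.2 :=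
    (Primrec.eq.comp (fst.comp he) (fst.comp hx)).and
      (Primrec.eq.comp (fst.comp (snd.comp he)) ha)
  have hite := Primrec.ite hcond hs (const [])
  have hts : Primrec fun p : (EFAData × List (Config k) × Bool) × Config k => p.1.1.2.1 :=
    fst.comp (snd.comp (fst.comp fst))
  have hX : Primrec fun p : EFAData × List (Config k) × Bool => p.2.1 := fst.comp snd
  exact list_flatMap hX (list_flatMap hts hite.to₂).to₂

theorem primrec_reach (k : ℕ) : Primrec₂ (reach k) := by
  have hw : Primrec fun p : EFAData × List Bool => p.2 := snd
  have h0 : Primrec fun _ : EFAData × List Bool => [((0, 0, 0) : Config k)] := const _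
  have hd : Primrec fun p : (EFAData × List Bool) × (List (Config k) × Bool) => p.1.1 :=
    fst.comp fst
  have hs := (primrec_reachStep k).comp (hd.pair snd)
  exact list_foldl hw h0 hs.to₂

theorem primrecRel_acceptingConfig (k : ℕ) :
    PrimrecRel fun (x : Config k) (d : EFAData) => AcceptingConfig k d x := by
  have hmem : PrimrecRel fun (L : List ℕ) (q : ℕ) => ∃ a ∈ L, a = q :=
    PrimrecRel.exists_mem_list Primrec.eq
  refine PrimrecPred.and ((hmem.comp (snd.comp (snd.comp snd)) (fst.comp fst)).of_eq ?_)
    (Primrec.eq.comp (fst.comp (snd.comp fst)) (const 0))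
  simp

theorem primrecRel_lowWord (k c : ℕ) :
    PrimrecRel fun (w : List Bool) (d : EFAData) => LowWord k c d w := by
  have hacc := primrecRel_acceptingConfig k
  have hlow : PrimrecRel fun (x : Config k) (d : EFAData) =>
      AcceptingConfig k d x ∧ x.2.2 ≤ c :=
    PrimrecPred.and hacc (nat_le.comp (snd.comp (snd.comp fst)) (const c))
  have hr : Primrec fun p : List Bool × EFAData => reach k p.2 p.1 :=
    (primrec_reach k).comp snd fst
  refine PrimrecPred.of_eq ((hacc.exists_mem_list.comp hr snd).not.or
    (hlow.exists_mem_list.comp hr snd)) fun p => ?_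
  rw [← imp_iff_not_or]
  rfl

/-- The list of all words of length at most `n`. -/
def wordsUpTo : ℕ → List (List Bool)
  | 0 => [[]]
  | n + 1 => [] :: (wordsUpTo n).flatMap fun w => [true :: w, false :: w]

theorem mem_wordsUpTo {n : ℕ} {w : List Bool} : w ∈ wordsUpTo n ↔ w.length ≤ n := by
  induction n generalizing w with
  | zero => simp [wordsUpTo]
  | succ n ih =>
    cases w with
    | nil => simp [wordsUpTo]
    | cons a w => cases a <;> simp [wordsUpTo, ih]

theorem primrec_wordsUpTo : Primrec wordsUpTo := by
  have hg : Primrec₂ fun (_ : ℕ) (L : List (List Bool)) =>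
      ([] : List Bool) :: L.flatMap fun w => [true :: w, false :: w] :=
    list_cons.comp (const []) (list_flatMap snd
      (list_cons.comp (list_cons.comp (const true) snd)
        (list_cons.comp (list_cons.comp (const false) snd) (const []))))
  refine (nat_rec₁ [[]] hg).of_eq fun n => ?_
  induction n with
  | zero => rfl
  | succ n ih => simp only [wordsUpTo, ← ih]

end Computability

/-- For every EFA `A` over `ℤ^k` (`k` positive) and every positive integer `c`, it is
algorithmically decidable whether `gmc_A(n) ≤ c` for all `n`. -/
theorem efa_int_vectors_gmc_le_decidable (k c : ℕ) (hk : 0 < k) (hc : 0 < c) :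
    ComputablePred (fun d : EFAData => ∀ n : ℕ, (toEFA k d).gmcFun n ≤ c) := by
  refine PrimrecPred.computablePred (((primrecRel_lowWord k c).forall_mem_list.comp
    (primrec_wordsUpTo.comp ((primrec_wordBound k c).comp .encode)) .id).of_eq fun d => ?_)
  rw [forall_gmcFun_le_iff]
  simp only [mem_wordsUpTo, id]
end

section
/- There exists an extended finite automaton A over the free group F₂ of rank 2 such that L(A) is not regular and gmc_A(n) ∈ O(log n). -/
open scoped Classical

variable {V M : Type} [Group M]

/-!
The automaton accepts exactly the words over `Option Bool` that are not prefixes of the infinite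
word `bits 0 # bits 1 # bits 2 # ⋯`, where `# = none` and binary expansions are written with the
least significant digit first. It guesses the block preceding the first error and the position of
that error inside the next block, and uses the register to compare the positions. Before the first
error, blocks have logarithmic length.
-/

namespace BinaryCounter

/-- A binary block followed by the separator `none`. -/
def block (t : List Bool) : List (Option Bool) := t.map some ++ [none]

@[simp] lemma block_nil : block [] = [none] := rfl

@[simp] lemma block_cons (b : Bool) (t : List Bool) : block (b :: t) = some b :: block t := rfl

/-- Addition of a carry to a binary expansion, least significant digit first. -/
def addCarry : Bool → List Bool → List Bool
  | false, [] => []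
  | true, [] => [true]
  | c, b :: t => (b ^^ c) :: addCarry (b && c) t

lemma addCarry_false (t : List Bool) : addCarry false t = t := by
  induction t with
  | nil => rfl
  | cons b t ih => simp [addCarry, ih]

lemma addCarry_true_bits (n : ℕ) : addCarry true n.bits = (n + 1).bits := by
  induction n using Nat.binaryRec' with
  | zero => simp [addCarry]
  | bit b n h ih =>
    rw [Nat.bits_append_bit n b h]
    cases b
    · have : Nat.bit false n + 1 = Nat.bit true n := by simp [Nat.bit]
      rw [this, Nat.bits_append_bit n true (by simp)]
      simp [addCarry, addCarry_false]
    · have : Nat.bit true n + 1 = Nat.bit false (n + 1) := by simp [Nat.bit]; ring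
      rw [this, Nat.bits_append_bit (n + 1) false (by simp)]
      simp [addCarry, ih]

/-- `Good t n w` : the word `w` is a prefix of `t # bits n # bits (n + 1) # ⋯`. -/
inductive Good : List Bool → ℕ → List (Option Bool) → Prop
  | nil (t : List Bool) (n : ℕ) : Good t n []
  | digit {t : List Bool} {n : ℕ} {w : List (Option Bool)} (b : Bool) (h : Good t n w) :
      Good (b :: t) n (some b :: w)
  | sep {n : ℕ} {w : List (Option Bool)} (h : Good n.bits (n + 1) w) : Good [] n (none :: w)

lemma good_block_append {t : List Bool} {n : ℕ} {r : List (Option Bool)} :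
    Good t n (block t ++ r) ↔ Good n.bits (n + 1) r := by
  induction t with
  | nil => exact ⟨fun h => by cases h; assumption, Good.sep⟩
  | cons b t ih => exact ⟨fun h => by cases h; exact ih.1 ‹_›, fun h => (ih.2 h).digit b⟩

lemma Good.eq_of_block {s t : List Bool} {n : ℕ} (h : Good t n (block s)) : s = t := by
  induction s generalizing t with
  | nil => cases h; rfl
  | cons b s ih => cases h with | digit _ h => rw [ih h]

/-- A word that is not good either has an error in the first block, or fails after it. -/
lemma exists_error_of_not_good {t : List Bool} {n : ℕ} {r : List (Option Bool)}
    (h : ¬ Good t n r) :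
    (∃ (v : List Bool) (a e : Option Bool) (r' : List (Option Bool)),
      r = v.map some ++ a :: r' ∧ (block t)[v.length]? = some e ∧ a ≠ e) ∨
    ∃ r', r = block t ++ r' ∧ ¬ Good n.bits (n + 1) r' := by
  induction t generalizing r with
  | nil =>
    match r with
    | [] => exact absurd (Good.nil _ _) h
    | none :: r => exact Or.inr ⟨r, rfl, fun h' => h h'.sep⟩
    | some b :: r => exact Or.inl ⟨[], some b, none, r, rfl, rfl, by simp⟩
  | cons b t ih =>
    match r with
    | [] => exact absurd (Good.nil _ _) h
    | none :: r => exact Or.inl ⟨[], none, some b, r, rfl, rfl, by simp⟩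
    | some b' :: r =>
      by_cases hb : b' = b
      · subst hb
        rcases ih (fun h' => h (h'.digit b')) with ⟨v, a, e, r', rfl, he, hae⟩ | ⟨r', rfl, hr⟩
        · exact Or.inl ⟨b' :: v, a, e, r', rfl, by simpa using he, hae⟩
        · exact Or.inr ⟨r', rfl, hr⟩
      · exact Or.inl ⟨[], some b', some b, r, rfl, rfl, by simpa using hb⟩

/-- States of the automaton: `first c` reads the block before the error, with current carry `c`;
`mid e` skips the rest of that block; `wait e` looks in the next block for a letter other than
`e`. -/
inductive State
  | start
  | skip
  | first (c : Bool)
  | mid (e : Option Bool)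
  | wait (e : Option Bool)
  | acc

noncomputable instance : Fintype State where
  elems := {.start, .skip, .acc} ∪ Finset.univ.image .first ∪ Finset.univ.image .mid ∪
    Finset.univ.image .wait
  complete q := by cases q <;> simp

/-- The generator used as a counter. -/
def gen : FreeGroup (Fin 2) := FreeGroup.of 0

lemma gen_zpow_eq_one {p : ℤ} (h : gen ^ p = 1) : p = 0 := by
  have := congrArg (FreeGroup.lift fun _ : Fin 2 => Multiplicative.ofAdd (1 : ℤ)) h
  rw [map_zpow, gen, FreeGroup.lift_apply_of, (FreeGroup.lift _).map_one, ← ofAdd_zsmul] at this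
  simpa using congrArg Multiplicative.toAdd this

/-- Transitions of the automaton. -/
inductive Trans : State → Option Bool → State → FreeGroup (Fin 2) → Prop
  | startError (b : Bool) : Trans .start (some b) .acc 1
  | startSkip {a : Option Bool} {s : State} {g : FreeGroup (Fin 2)} (h : Trans .skip a s g) :
      Trans .start a s g
  | startFirst {a : Option Bool} {s : State} {g : FreeGroup (Fin 2)}
      (h : Trans (.first true) a s g) : Trans .start a s g
  | skip (a : Option Bool) : Trans .skip a .skip 1
  | skipFirst : Trans .skip none (.first true) 1
  | firstPush (c b : Bool) : Trans (.first c) (some b) (.first (b && c)) gen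
  | firstDigit (c b : Bool) : Trans (.first c) (some b) (.mid (some (b ^^ c))) 1
  | firstEnd : Trans (.first false) none (.wait none) 1
  | firstCarry : Trans (.first true) none (.wait (some true)) 1
  | firstCarryEnd : Trans (.first true) none (.wait none) gen
  | mid (e : Option Bool) (b : Bool) : Trans (.mid e) (some b) (.mid e) 1
  | midEnd (e : Option Bool) : Trans (.mid e) none (.wait e) 1
  | waitPop (e : Option Bool) (b : Bool) : Trans (.wait e) (some b) (.wait e) gen⁻¹
  | waitError {e a : Option Bool} (h : a ≠ e) : Trans (.wait e) a .acc 1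
  | acc (a : Option Bool) : Trans .acc a .acc 1

lemma Trans.label_mem {q s : State} {a : Option Bool} {g : FreeGroup (Fin 2)}
    (h : Trans q a s g) : g ∈ ({1, gen, gen⁻¹} : Set (FreeGroup (Fin 2))) := by
  induction h <;> first | assumption | simp

/-- The automaton detecting errors in a binary counter. -/
noncomputable def automaton : EFA (Option Bool) (FreeGroup (Fin 2)) where
  Q := State
  δ q a := {p | Trans q a p.1 p.2}
  fin q a := by
    refine ((Set.finite_univ (α := State)).prod
      (Set.toFinite ({1, gen, gen⁻¹} : Set (FreeGroup (Fin 2))))).subset ?_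
    exact fun p hp => ⟨trivial, Trans.label_mem hp⟩
  q₀ := .start
  F := {.acc}

/-- Acceptance from a configuration with at most `B` non-identity group elements. -/
def AcceptsWithin (q : State) (w : List (Option Bool)) (m : FreeGroup (Fin 2)) (B : ℕ) : Prop :=
  ∃ k ≤ B, automaton.Steps (q, w, m) (State.acc, [], 1) k

lemma AcceptsWithin.cons {q s : State} {a : Option Bool} {w : List (Option Bool)}
    {m g : FreeGroup (Fin 2)} {B : ℕ} (ht : Trans q a s g) (h : AcceptsWithin s w (m * g) B) :
    AcceptsWithin q (a :: w) m (B + 1) := by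
  obtain ⟨k, hk, h⟩ := h
  refine ⟨_, ?_, EFA.Steps.step (A := automaton) (r := g) ht h⟩
  split <;> omega

lemma AcceptsWithin.cons_one {q s : State} {a : Option Bool} {w : List (Option Bool)}
    {m : FreeGroup (Fin 2)} {B : ℕ} (ht : Trans q a s 1) (h : AcceptsWithin s w m B) :
    AcceptsWithin q (a :: w) m B := by
  obtain ⟨k, hk, h⟩ := h
  refine ⟨_, ?_, EFA.Steps.step (A := automaton) (r := 1) ht (by rwa [mul_one])⟩
  simpa using hk

lemma AcceptsWithin.mono {q : State} {w : List (Option Bool)} {m : FreeGroup (Fin 2)} {B B' : ℕ}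
    (h : AcceptsWithin q w m B) (hB : B ≤ B') : AcceptsWithin q w m B' := by
  obtain ⟨k, hk, h⟩ := h
  exact ⟨k, hk.trans hB, h⟩

/-- Acceptance from a configuration. -/
def Accepts (q : State) (w : List (Option Bool)) (m : FreeGroup (Fin 2)) : Prop :=
  ∃ k, automaton.Steps (q, w, m) (State.acc, [], 1) k

lemma Accepts.of_nil {q : State} {m : FreeGroup (Fin 2)} (h : Accepts q [] m) :
    q = .acc ∧ m = 1 := by
  obtain ⟨k, h⟩ := h
  cases h
  exact ⟨rfl, rfl⟩

lemma Accepts.of_cons {q : State} {a : Option Bool} {w : List (Option Bool)}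
    {m : FreeGroup (Fin 2)} (h : Accepts q (a :: w) m) :
    ∃ s g, Trans q a s g ∧ Accepts s w (m * g) := by
  obtain ⟨k, h⟩ := h
  cases h with
  | step ht h => exact ⟨_, _, ht, _, h⟩

/-! ### Good words are rejected -/

lemma eq_one_of_accepts_acc {w : List (Option Bool)} {m : FreeGroup (Fin 2)}
    (h : Accepts .acc w m) : m = 1 := by
  induction w with
  | nil => exact h.of_nil.2
  | cons a w ih =>
    obtain ⟨s, g, ht, h⟩ := h.of_cons
    cases ht
    exact ih (by simpa using h)

lemma Good.not_accepts_wait {t : List Bool} {n : ℕ} {w : List (Option Bool)} {e : Option Bool}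
    {p : ℤ} (hw : Good t n w) (hp : ∀ i : ℕ, p = i → (block t)[i]? = some e) :
    ¬ Accepts (.wait e) w (gen ^ p) := by
  intro h
  induction hw generalizing p with
  | nil => cases h.of_nil.1
  | digit b hw ih =>
    obtain ⟨s, g, ht, h⟩ := h.of_cons
    cases ht with
    | waitPop =>
      rw [← zpow_sub_one] at h
      refine ih (fun i hi => ?_) h
      simpa using hp (i + 1) (by push_cast; omega)
    | waitError hne =>
      have hp0 := gen_zpow_eq_one (by simpa using eq_one_of_accepts_acc h)
      exact hne (by simpa using hp 0 (by simpa using hp0))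
  | sep hw ih =>
    obtain ⟨s, g, ht, h⟩ := h.of_cons
    cases ht with
    | waitError hne =>
      have hp0 := gen_zpow_eq_one (by simpa using eq_one_of_accepts_acc h)
      exact hne (by simpa using hp 0 (by simpa using hp0))

lemma Good.not_accepts_wait_pow {t : List Bool} {n p : ℕ} {w : List (Option Bool)}
    {e : Option Bool} (hw : Good t n w) (hp : (block t)[p]? = some e) :
    ¬ Accepts (.wait e) w (gen ^ p) := by
  rw [← zpow_natCast]
  refine hw.not_accepts_wait fun i hi => ?_
  rwa [← Int.ofNat_inj.1 hi]

lemma Good.not_accepts_mid {t : List Bool} {n p : ℕ} {w : List (Option Bool)} {e : Option Bool}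
    (hw : Good t n w) (hp : (block n.bits)[p]? = some e) :
    ¬ Accepts (.mid e) w (gen ^ p) := by
  intro h
  induction hw with
  | nil => cases h.of_nil.1
  | digit b hw ih =>
    obtain ⟨s, g, ht, h⟩ := h.of_cons
    cases ht
    exact ih hp (by simpa using h)
  | sep hw ih =>
    obtain ⟨s, g, ht, h⟩ := h.of_cons
    cases ht
    exact hw.not_accepts_wait_pow hp (by simpa using h)

lemma Good.not_accepts_first {t l : List Bool} {n : ℕ} {w : List (Option Bool)} {c : Bool}
    (hw : Good t n w) (hl : n.bits = l ++ addCarry c t) :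
    ¬ Accepts (.first c) w (gen ^ l.length) := by
  intro h
  induction hw generalizing l c with
  | nil => cases h.of_nil.1
  | digit b hw ih =>
    obtain ⟨s, g, ht, h⟩ := h.of_cons
    cases ht with
    | firstPush =>
      refine ih (l := l ++ [b ^^ c]) (c := b && c) (by simpa [addCarry] using hl) ?_
      simpa [pow_succ] using h
    | firstDigit =>
      refine hw.not_accepts_mid ?_ (by simpa using h)
      simp [hl, block, addCarry]
  | sep hw ih =>
    obtain ⟨s, g, ht, h⟩ := h.of_cons
    cases ht with
    | firstEnd =>
      refine hw.not_accepts_wait_pow ?_ (by simpa using h)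
      simp [hl, block, addCarry]
    | firstCarry =>
      refine hw.not_accepts_wait_pow ?_ (by simpa using h)
      simp [hl, block, addCarry]
    | firstCarryEnd =>
      rw [← pow_succ] at h
      refine hw.not_accepts_wait_pow ?_ h
      simp [hl, block, addCarry]

lemma Good.not_accepts_skip {t : List Bool} {n : ℕ} {w : List (Option Bool)}
    (hw : Good t n w) : ¬ Accepts .skip w 1 := by
  intro h
  induction hw with
  | nil => cases h.of_nil.1
  | digit b hw ih =>
    obtain ⟨s, g, ht, h⟩ := h.of_cons
    cases ht
    exact ih (by simpa using h)
  | @sep n w hw ih =>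
    obtain ⟨s, g, ht, h⟩ := h.of_cons
    cases ht with
    | skip => exact ih (by simpa using h)
    | skipFirst =>
      exact hw.not_accepts_first (l := []) (addCarry_true_bits n).symm (by simpa using h)

lemma Good.not_accepts_start {w : List (Option Bool)} (hw : Good [] 1 w) :
    ¬ Accepts .start w 1 := by
  intro h
  cases hw with
  | nil => cases h.of_nil.1
  | sep hw =>
    obtain ⟨s, g, ht, k, h⟩ := h.of_cons
    cases ht with
    | startSkip ht =>
      exact hw.sep.not_accepts_skip ⟨_, EFA.Steps.step (A := automaton) ht h⟩
    | startFirst ht =>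
      exact hw.sep.not_accepts_first (l := []) (by simp [addCarry])
        ⟨_, EFA.Steps.step (A := automaton) ht h⟩

/-! ### Other words are accepted cheaply -/

lemma acceptsWithin_acc (w : List (Option Bool)) : AcceptsWithin .acc w 1 0 := by
  induction w with
  | nil => exact ⟨0, le_rfl, EFA.Steps.refl _⟩
  | cons a w ih => exact ih.cons_one (.acc a)

lemma acceptsWithin_wait (v : List Bool) {a e : Option Bool} (hae : a ≠ e)
    (r : List (Option Bool)) :
    AcceptsWithin (.wait e) (v.map some ++ a :: r) (gen ^ v.length) v.length := by
  induction v with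
  | nil => exact (acceptsWithin_acc r).cons_one (.waitError hae)
  | cons b v ih => exact AcceptsWithin.cons (.waitPop e b) (by simpa [pow_succ] using ih)

lemma AcceptsWithin.mid {e : Option Bool} {r : List (Option Bool)} {m : FreeGroup (Fin 2)} {B : ℕ}
    (h : AcceptsWithin (.wait e) r m B) (s : List Bool) :
    AcceptsWithin (.mid e) (block s ++ r) m B := by
  induction s with
  | nil => exact h.cons_one (.midEnd e)
  | cons b s ih => exact ih.cons_one (.mid e b)

lemma acceptsWithin_first {s v : List Bool} {c : Bool} {a e : Option Bool} {i j : ℕ}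
    (r : List (Option Bool)) (hv : i + j = v.length)
    (he : (block (addCarry c s))[j]? = some e) (hae : a ≠ e) :
    AcceptsWithin (.first c) (block s ++ (v.map some ++ a :: r)) (gen ^ i) (j + v.length) := by
  have hw := acceptsWithin_wait v hae r
  induction s generalizing c i j with
  | nil =>
    rcases c with _ | _
    · match j with
      | 0 =>
        obtain rfl : none = e := by simpa [addCarry] using he
        obtain rfl : i = v.length := by omega
        exact (hw.cons_one .firstEnd).mono (by omega)
      | j + 1 => simp [addCarry] at he
    · match j with
      | 0 =>
        obtain rfl : some true = e := by simpa [addCarry] using he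
        obtain rfl : i = v.length := by omega
        exact (hw.cons_one .firstCarry).mono (by omega)
      | 1 =>
        obtain rfl : none = e := by simpa [addCarry] using he
        refine AcceptsWithin.mono (AcceptsWithin.cons .firstCarryEnd ?_) (Nat.add_comm _ _).le
        rwa [← pow_succ, hv]
      | j + 2 => simp [addCarry] at he
  | cons b s ih =>
    match j with
    | 0 =>
      obtain rfl : some (b ^^ c) = e := by simpa [addCarry] using he
      obtain rfl : i = v.length := by omega
      exact ((hw.mid s).cons_one (.firstDigit c b)).mono (by omega)
    | j + 1 =>
      have := ih (c := b && c) (i := i + 1) (j := j) (by omega) (by simpa [addCarry] using he)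
      refine AcceptsWithin.mono (AcceptsWithin.cons (.firstPush c b) (B := j + v.length) ?_)
        (by omega)
      rwa [← pow_succ]

lemma AcceptsWithin.skip {r : List (Option Bool)} {B : ℕ}
    (h : AcceptsWithin (.first true) r 1 B ∨ AcceptsWithin .skip r 1 B) (s : List Bool) :
    AcceptsWithin .skip (block s ++ r) 1 B := by
  induction s with
  | nil => exact h.elim (fun h => h.cons_one .skipFirst) (fun h => h.cons_one (.skip none))
  | cons b s ih => exact ih.cons_one (.skip (some b))

lemma acceptsWithin_of_not_good {n : ℕ} {r : List (Option Bool)} {N : ℕ}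
    (hr : ¬ Good (n + 1).bits (n + 2) r) (hN : n + r.length < N) :
    AcceptsWithin (.first true) (block n.bits ++ r) 1 (2 * N.size) ∨
      AcceptsWithin .skip (block n.bits ++ r) 1 (2 * N.size) := by
  induction hl : r.length using Nat.strong_induction_on generalizing n r with
  | _ l ih =>
    rcases exists_error_of_not_good hr with ⟨v, a, e, r', rfl, he, hae⟩ | ⟨r', rfl, hr'⟩
    · left
      have hv : v.length < (block (n + 1).bits).length := (List.getElem?_eq_some_iff.1 he).1
      have hs : (n + 1).size ≤ N.size := Nat.size_le_size (by omega)
      rw [← addCarry_true_bits] at he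
      refine (acceptsWithin_first (i := 0) r' (by omega) he hae).mono ?_
      simp only [block, List.length_append, List.length_map, List.length_singleton,
        Nat.size_eq_bits_len] at hv
      omega
    · right
      have hlen : (block (n + 1).bits ++ r').length = (n + 1).bits.length + 1 + r'.length := by
        simp [block, Nat.add_assoc, Nat.add_comm 1]
      exact AcceptsWithin.skip (ih r'.length (by omega) hr' (by omega) rfl) _

lemma acceptsWithin_start {w : List (Option Bool)} (hw : ¬ Good [] 1 w) :
    AcceptsWithin .start w 1 (2 * w.length.size) := by
  match w with
  | [] => exact absurd (Good.nil _ _) hw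
  | some b :: w =>
    exact AcceptsWithin.mono ((acceptsWithin_acc w).cons_one (.startError b)) (Nat.zero_le _)
  | none :: w =>
    have hN : 0 + w.length < (none :: w).length := by simp
    rcases acceptsWithin_of_not_good (n := 0) (fun h => hw (Good.sep (by simpa using h))) hN with
      ⟨k, hk, h⟩ | ⟨k, hk, h⟩ <;> rw [Nat.zero_bits] at h <;> cases h with
      | step ht h => ?_
    · exact ⟨_, hk, EFA.Steps.step (A := automaton) (Trans.startFirst ht) h⟩
    · exact ⟨_, hk, EFA.Steps.step (A := automaton) (Trans.startSkip ht) h⟩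

lemma mem_language_iff {w : List (Option Bool)} : w ∈ automaton.language ↔ ¬ Good [] 1 w := by
  constructor
  · rintro ⟨k, q, rfl, h⟩ hw
    exact hw.not_accepts_start ⟨k, h⟩
  · intro hw
    obtain ⟨k, -, h⟩ := acceptsWithin_start hw
    exact ⟨k, .acc, rfl, h⟩

/-- The word `bits 0 # ⋯ # bits (m - 1) #`. -/
def counterWord : ℕ → List (Option Bool)
  | 0 => []
  | m + 1 => counterWord m ++ block m.bits

lemma good_counterWord_append {m : ℕ} {r : List (Option Bool)} :
    Good [] 1 (counterWord m ++ r) ↔ Good m.bits (m + 1) r := by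
  induction m generalizing r with
  | zero => simp [counterWord]
  | succ m ih => rw [counterWord, List.append_assoc, ih, good_block_append]

lemma bits_injective : Function.Injective Nat.bits := fun m n h =>
  Nat.digits.injective 2 (by rw [Nat.digits_two_eq_bits, h, Nat.digits_two_eq_bits])

lemma not_isRegular_language : ¬ automaton.language.IsRegular := by
  rw [Language.isRegular_iff_finite_range_leftQuotient]
  refine fun hfin => Set.infinite_range_of_injective (f := fun m =>
    automaton.language.leftQuotient (counterWord m)) ?_
      (hfin.subset (Set.range_comp_subset_range counterWord automaton.language.leftQuotient))
  intro m n h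
  have hm : block m.bits ∉ automaton.language.leftQuotient (counterWord m) := by
    rw [Language.mem_leftQuotient, mem_language_iff, not_not, good_counterWord_append,
      ← List.append_nil (block m.bits), good_block_append]
    exact Good.nil _ _
  have hn : block m.bits ∉ automaton.language.leftQuotient (counterWord n) := by
    simpa only [← h] using hm
  rw [Language.mem_leftQuotient, mem_language_iff, not_not, good_counterWord_append] at hn
  exact bits_injective hn.eq_of_block

lemma gmcW_le (w : List (Option Bool)) : automaton.gmcW w ≤ 2 * w.length.size := by
  by_cases hw : Good [] 1 w
  · have : {k | automaton.AcceptsN w k} = ∅ :=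
      Set.eq_empty_of_forall_notMem fun k hk => mem_language_iff.1 ⟨k, hk⟩ hw
    simp [EFA.gmcW, this]
  · obtain ⟨k, hk, h⟩ := acceptsWithin_start hw
    exact le_trans (Nat.sInf_le ⟨.acc, rfl, h⟩) hk

end BinaryCounter

/-- There is an EFA over the free group `F₂` of rank 2 accepting a non-regular language with
group memory complexity in `O(log n)`. -/
theorem efa_free_group_log :
    ∃ (V : Type) (_ : Fintype V) (A : EFA V (FreeGroup (Fin 2))),
      ¬ A.language.IsRegular ∧ InO A.gmcFun (fun n => Nat.log 2 n) := by
  refine ⟨Option Bool, inferInstance, BinaryCounter.automaton,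
    BinaryCounter.not_isRegular_language, 2, fun n => csSup_le' ?_⟩
  rintro _ ⟨w, rfl, rfl⟩
  have hlog : w.length.size ≤ Nat.log 2 w.length + 1 :=
    Nat.size_le.2 (Nat.lt_pow_succ_log_self one_lt_two _)
  have := BinaryCounter.gmcW_le w
  dsimp only
  omega
end
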